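/- Let G be a finite group. Then |CD(G)| = |L(G)| - 2 if and only if G is isomorphic to the cyclic group Z_{p^2} of order p^2 for some prime p. -/

import Mathlib

/-- The Chermak-Delgado measure of a subgroup `H` of `G`: `m_G(H) = |H| * |C_G(H)|`. -/
noncomputable def cdMeasure (G : Type*) [Group G] (H : Subgroup G) : ℕ :=
  Nat.card H * Nat.card (Subgroup.centralizer (H : Set G))

/-- The Chermak-Delgado lattice of `G`: the set of subgroups whose Chermak-Delgado
measure is maximal among all subgroups of `G`. -/
def cdLattice (G : Type*) [Group G] : Set (Subgroup G) :=
  {H | ∀ K : Subgroup G, cdMeasure G K ≤ cdMeasure G H}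

section ChermakDelgado

variable {G : Type*} [Group G]

open Subgroup

theorem cdMeasure_le_map [Finite G] (e : G ≃* G) (H : Subgroup G) :
    cdMeasure G H ≤ cdMeasure G (H.map e.toMonoidHom) := by
  have h1 : Nat.card (H.map e.toMonoidHom) = Nat.card H :=
    Subgroup.card_map_of_injective e.injective
  have h2 : Nat.card ((centralizer (H : Set G)).map e.toMonoidHom)
      = Nat.card (centralizer (H : Set G)) := Subgroup.card_map_of_injective e.injective
  rw [cdMeasure, cdMeasure, h1, ← h2]
  gcongr
  exact Subgroup.card_le_of_le (by
    rw [coe_map]; exact map_centralizer_le_centralizer_image _ _)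

theorem map_mem_cdLattice [Finite G] (e : G ≃* G) {H : Subgroup G} (hH : H ∈ cdLattice G) :
    H.map e.toMonoidHom ∈ cdLattice G := fun K => (hH K).trans (cdMeasure_le_map e H)

theorem map_mem_cdLattice_iff [Finite G] (e : G ≃* G) {H : Subgroup G} :
    H.map e.toMonoidHom ∈ cdLattice G ↔ H ∈ cdLattice G := by
  refine ⟨fun h => ?_, map_mem_cdLattice e⟩
  have := map_mem_cdLattice e.symm h
  rwa [Subgroup.map_map, show e.symm.toMonoidHom.comp e.toMonoidHom = MonoidHom.id G by
    ext; simp, Subgroup.map_id] at this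

theorem normal_of_map_conj_eq {H : Subgroup G}
    (h : ∀ g : G, H.map (MulAut.conj g).toMonoidHom = H) : H.Normal :=
  ⟨fun n hn g => by
    rw [← h g]
    exact ⟨n, hn, by simp⟩⟩

theorem cdMeasure_pos [Finite G] (H : Subgroup G) : 0 < cdMeasure G H :=
  Nat.mul_pos Nat.card_pos Nat.card_pos

theorem card_mul_card_le_sup_inf [Finite G] (H K : Subgroup G) :
    Nat.card H * Nat.card K ≤ Nat.card (H ⊔ K : Subgroup G) * Nat.card (H ⊓ K : Subgroup G) := by
  have h1 : Nat.card (H ⊓ K : Subgroup G) * K.relIndex H = Nat.card H := by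
    rw [← inf_relIndex_left]; simpa using relIndex_mul_relIndex ⊥ (H ⊓ K) H bot_le inf_le_left
  have h2 : Nat.card K * K.relIndex (H ⊔ K) = Nat.card (H ⊔ K : Subgroup G) :=
    by simpa using relIndex_mul_relIndex ⊥ K (H ⊔ K) bot_le le_sup_right
  have h3 : K.relIndex H ≤ K.relIndex (H ⊔ K) :=
    relIndex_le_of_le_right le_sup_left (by
      intro h0; rw [h0] at h2; exact Nat.card_pos.ne' (by simpa using h2.symm))
  rw [← h1, ← h2]
  nlinarith [Nat.mul_le_mul_left (Nat.card (H ⊓ K : Subgroup G) * Nat.card K) h3]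

/-- The measure is submultiplicative along `H`, `K`, `H ⊔ K`, `H ⊓ K`; equality forces
`|H ⊔ K| * |H ⊓ K| = |H| * |K|`. -/
theorem cdMeasure_mul_le [Finite G] (H K : Subgroup G) :
    cdMeasure G H * cdMeasure G K ≤ cdMeasure G (H ⊔ K) * cdMeasure G (H ⊓ K) ∧
    (cdMeasure G (H ⊔ K) * cdMeasure G (H ⊓ K) = cdMeasure G H * cdMeasure G K →
      Nat.card (H ⊔ K : Subgroup G) * Nat.card (H ⊓ K : Subgroup G) = Nat.card H * Nat.card K) := by
  have h1 := card_mul_card_le_sup_inf H K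
  have h2 := card_mul_card_le_sup_inf (centralizer (H : Set G)) (centralizer (K : Set G))
  have h3 : Nat.card (centralizer (H : Set G) ⊔ centralizer (K : Set G) : Subgroup G)
      ≤ Nat.card (centralizer ((H ⊓ K : Subgroup G) : Set G)) :=
    Subgroup.card_le_of_le (sup_le (centralizer_le inf_le_left) (centralizer_le inf_le_right))
  have h4 : Nat.card (centralizer (H : Set G) ⊓ centralizer (K : Set G) : Subgroup G)
      ≤ Nat.card (centralizer ((H ⊔ K : Subgroup G) : Set G)) :=
    Subgroup.card_le_of_le (by
      rw [le_centralizer_iff]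
      exact sup_le (le_centralizer_iff.1 inf_le_left) (le_centralizer_iff.1 inf_le_right))
  have h5 := h2.trans (Nat.mul_le_mul h3 h4)
  have h6 : 0 < Nat.card (centralizer (H : Set G)) * Nat.card (centralizer (K : Set G)) :=
    Nat.mul_pos Nat.card_pos Nat.card_pos
  simp only [cdMeasure]
  constructor
  · nlinarith [Nat.mul_le_mul h1 h5]
  · intro h
    refine le_antisymm ?_ h1
    by_contra! hlt
    nlinarith [Nat.mul_lt_mul_of_lt_of_le hlt h5 (h6.trans_le h5)]

theorem cdMeasure_eq_of_mem {H K : Subgroup G} (hH : H ∈ cdLattice G) (hK : K ∈ cdLattice G) :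
    cdMeasure G H = cdMeasure G K := le_antisymm (hK H) (hH K)

theorem mem_cdLattice_of_le {H K : Subgroup G} (hH : H ∈ cdLattice G)
    (h : cdMeasure G H ≤ cdMeasure G K) : K ∈ cdLattice G := fun L => (hH L).trans h

theorem sup_inf_mem_cdLattice [Finite G] {H K : Subgroup G} (hH : H ∈ cdLattice G) (hK : K ∈ cdLattice G) :
    H ⊔ K ∈ cdLattice G ∧ H ⊓ K ∈ cdLattice G ∧
    Nat.card (H ⊔ K : Subgroup G) * Nat.card (H ⊓ K : Subgroup G) = Nat.card H * Nat.card K := by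
  obtain ⟨h1, h2⟩ := cdMeasure_mul_le H K
  have h3 := cdMeasure_eq_of_mem hH hK
  have h4 := hH (H ⊔ K)
  have h5 := hH (H ⊓ K)
  have h6 := cdMeasure_pos H
  have h7 : cdMeasure G (H ⊔ K) = cdMeasure G H := by
    rw [← h3] at h1; by_contra h
    nlinarith [lt_of_le_of_ne h4 h]
  have h8 : cdMeasure G (H ⊓ K) = cdMeasure G H := by
    rw [← h3] at h1; by_contra h
    nlinarith [lt_of_le_of_ne h5 h]
  exact ⟨mem_cdLattice_of_le hH h7.ge, mem_cdLattice_of_le hH h8.ge, h2 (by rw [h7, h8, ← h3])⟩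

theorem cdLattice_nonempty [Finite G] : (cdLattice G).Nonempty :=
  (Set.toFinite (Set.univ : Set (Subgroup G))).exists_maximalFor (cdMeasure G) _ ⟨⊥, trivial⟩
    |>.imp fun H hH K => (le_total (cdMeasure G K) (cdMeasure G H)).elim id fun h =>
      hH.2 trivial h

theorem cdMeasure_bot : cdMeasure G ⊥ = Nat.card G := by
  simp [cdMeasure, centralizer_eq_top_iff_subset.2]

theorem cdMeasure_top : cdMeasure G ⊤ = Nat.card G * Nat.card (center G) := by
  simp [cdMeasure, centralizer_univ]

theorem cdMeasure_center : cdMeasure G (center G) = Nat.card G * Nat.card (center G) := by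
  simp [cdMeasure, mul_comm]

theorem center_le_of_mem_cdLattice [Finite G] {H : Subgroup G} (hH : H ∈ cdLattice G) : center G ≤ H := by
  have h1 := hH (centralizer (H : Set G))
  have h2 : H ≤ centralizer (centralizer (H : Set G) : Set G) := le_centralizer_iff.1 le_rfl
  have h3 : Nat.card (centralizer (centralizer (H : Set G) : Set G)) ≤ Nat.card H := by
    rw [cdMeasure, cdMeasure, mul_comm] at h1
    exact Nat.le_of_mul_le_mul_right h1 Nat.card_pos
  have h4 : H = centralizer (centralizer (H : Set G) : Set G) :=
    Subgroup.eq_of_le_of_card_ge h2 h3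
  rw [h4]
  exact center_le_centralizer _

theorem exists_le_card_prime [Finite G] {H : Subgroup G} (hH : H ≠ ⊥) :
    ∃ R ≤ H, (Nat.card R).Prime := by
  have h1 : Nat.card H ≠ 1 := fun h => hH (Subgroup.card_eq_one.1 h)
  have := Fact.mk (Nat.minFac_prime h1)
  obtain ⟨x, hx⟩ := exists_prime_orderOf_dvd_card' (G := H) _ (Nat.minFac_dvd (Nat.card H))
  refine ⟨zpowers (x : G), zpowers_le.2 x.2, ?_⟩
  rw [Nat.card_zpowers, Subgroup.orderOf_coe, hx]
  exact Nat.minFac_prime h1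

theorem eq_bot_or_eq_of_le_card_prime {R H : Subgroup G} (hR : (Nat.card R).Prime) (h : H ≤ R) :
    H = ⊥ ∨ H = R := by
  have : Finite R := Nat.finite_of_card_ne_zero hR.ne_zero
  rcases (Nat.dvd_prime hR).1 (Subgroup.card_dvd_of_le h) with h1 | h1
  · exact Or.inl (Subgroup.card_eq_one.1 h1)
  · exact Or.inr (Subgroup.eq_of_le_of_card_ge h h1.ge)

theorem ne_bot_of_card_prime {R : Subgroup G} (hR : (Nat.card R).Prime) : R ≠ ⊥ := by
  rintro rfl
  exact Nat.not_prime_one (by simpa using hR)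

theorem isPGroup_of_forall_card_prime [Finite G] {p : ℕ}
    (h : ∀ R : Subgroup G, (Nat.card R).Prime → Nat.card R = p) : IsPGroup p G := by
  refine IsPGroup.of_card (n := (Nat.card G).primeFactorsList.length)
    (Nat.eq_prime_pow_of_unique_prime_dvd Nat.card_pos.ne' fun {q} hq hd => ?_)
  have := Fact.mk hq
  obtain ⟨x, hx⟩ := exists_prime_orderOf_dvd_card' (G := G) q hd
  rw [← h (zpowers x) (by rwa [Nat.card_zpowers, hx]), Nat.card_zpowers, hx]

theorem card_lt_of_normal_of_card_prime [Finite G] {K : Subgroup G} [K.Normal] (hK : (Nat.card K).Prime) :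
    Nat.card G < Nat.card K * Nat.card (centralizer (K : Set G)) := by
  have := Fact.mk hK
  have hc : IsCyclic K := isCyclic_of_prime_card rfl
  have hker : (MulAut.conjNormal (H := K)).ker ≤ centralizer (K : Set G) := by
    intro g hg
    rw [mem_centralizer_iff]
    intro k hk
    have := congrArg (fun f : MulAut K => ((f ⟨k, hk⟩ : K) : G)) (MonoidHom.mem_ker.1 hg)
    simp only [MulAut.conjNormal_apply, MulAut.one_apply] at this
    rw [mul_inv_eq_iff_eq_mul] at this
    exact this.symm
  have h1 := card_mul_index (MulAut.conjNormal (H := K)).ker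
  rw [index_ker] at h1
  have h2 : Nat.card (MulAut.conjNormal (H := K)).range ≤ Nat.card (MulAut K) :=
    Subgroup.card_le_card_group _
  rw [hc.card_mulAut, Nat.totient_prime hK] at h2
  have h3 := Subgroup.card_le_of_le hker
  have h4 : Nat.card (centralizer (K : Set G)) > 0 := Nat.card_pos
  have h5 := hK.pos
  calc Nat.card G ≤ Nat.card (centralizer (K : Set G)) * (Nat.card K - 1) :=
        h1 ▸ Nat.mul_le_mul h3 h2
    _ < _ := by rw [mul_comm]; exact Nat.mul_lt_mul_of_pos_right (by lia) h4

theorem center_ne_bot_of_isPGroup [Finite G] [Nontrivial G] {p : ℕ} (hp : p.Prime) (h : IsPGroup p G) :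
    center G ≠ ⊥ :=
  have := Fact.mk hp
  h.bot_lt_center.ne'

/-- In a centreless group whose trivial subgroup has maximal measure, no subgroup of prime order
has maximal measure. -/
theorem notMem_cdLattice_of_card_prime [Finite G] (hZ : center G = ⊥) (hbot : ⊥ ∈ cdLattice G)
    {R : Subgroup G} (hR : (Nat.card R).Prime) : R ∉ cdLattice G := by
  intro hRL
  set p := Nat.card R with hp
  have := Fact.mk hR
  obtain ⟨N, ⟨hNL, hRN, hNp⟩, hmax⟩ :=
    (Set.toFinite {N : Subgroup G | N ∈ cdLattice G ∧ R ≤ N ∧ IsPGroup p N}).exists_maximal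
      ⟨R, hRL, le_rfl, IsPGroup.of_card (n := 1) (by simp [hp])⟩
  obtain ⟨k, hk⟩ := IsPGroup.iff_card.1 hNp
  have hle : ∀ g : G, N.map (MulAut.conj g).toMonoidHom ≤ N := by
    intro g
    have hc : Nat.card (N.map (MulAut.conj g).toMonoidHom) = Nat.card N :=
      Subgroup.card_map_of_injective (MulAut.conj g).injective
    obtain ⟨h1, -, h3⟩ := sup_inf_mem_cdLattice hNL (map_mem_cdLattice (MulAut.conj g) hNL)
    rw [hc, hk, ← pow_add] at h3
    obtain ⟨m, -, hm⟩ := (Nat.dvd_prime_pow hR).1 (Dvd.intro _ h3)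
    exact le_sup_right.trans
      (hmax ⟨h1, hRN.trans le_sup_left, IsPGroup.of_card hm⟩ le_sup_left)
  have hN : N.Normal := ⟨fun n hn g => hle g ⟨n, hn, by simp⟩⟩
  have hidx : (centralizer (N : Set G)).index = p ^ k := by
    have h1 := card_mul_index (centralizer (N : Set G))
    have h2 := cdMeasure_eq_of_mem hNL hbot
    rw [cdMeasure_bot, cdMeasure, ← h1, hk, mul_comm] at h2
    exact (Nat.eq_of_mul_eq_mul_left Nat.card_pos h2).symm
  obtain ⟨S, hS⟩ := hNp.exists_le_sylow
  let _ : MulAction S N :=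
    MulAction.compHom N ((MulAut.conjNormal (H := N)).comp (S : Subgroup G).subtype)
  have hsmul : ∀ (s : S) (n : N), ((s • n : N) : G) = s * n * (s : G)⁻¹ := fun s n =>
    MulAut.conjNormal_apply (s : G) n
  have hfix1 : (1 : N) ∈ MulAction.fixedPoints S N := fun s => Subtype.ext (by simp [hsmul])
  obtain ⟨n, hn, hn1⟩ := S.isPGroup'.exists_fixed_point_of_prime_dvd_card_of_fixed_point N
    (hp ▸ Subgroup.card_dvd_of_le hRN) hfix1
  have hSn : (S : Subgroup G) ≤ centralizer {(n : G)} := fun s hs => by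
    have := congrArg Subtype.val (hn ⟨s, hs⟩)
    rw [hsmul, mul_inv_eq_iff_eq_mul] at this
    exact mem_centralizer_singleton_iff.2 this
  have hNn : centralizer (N : Set G) ≤ centralizer {(n : G)} :=
    centralizer_le (by simp)
  have h1 := index_dvd_of_le hNn
  rw [hidx] at h1
  obtain ⟨m, -, hm⟩ := (Nat.dvd_prime_pow hR).1 h1
  have h2 := index_dvd_of_le hSn
  have hm0 : m = 0 := by
    by_contra h0
    exact S.not_dvd_index ((hm ▸ dvd_pow_self p h0).trans h2)
  rw [hm0, pow_zero, index_eq_one] at hm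
  have h3 : (n : G) ∈ center G := mem_center_iff.2 fun g =>
    mem_centralizer_singleton_iff.1 (hm ▸ mem_top g)
  rw [hZ, mem_bot] at h3
  exact hn1 (Subtype.ext h3.symm)

/-- A nontrivial group with at most two subgroups outside `CD(G)` has nontrivial centre. -/
theorem center_ne_bot_of_notMem_cdLattice_iff [Finite G] [Nontrivial G] {A B : Subgroup G}
    (h : ∀ H : Subgroup G, H ∉ cdLattice G ↔ H = A ∨ H = B) : center G ≠ ⊥ := by
  intro hZ
  have hP : ∀ p : ℕ, p.Prime → ¬ ∀ R : Subgroup G, (Nat.card R).Prime → Nat.card R = p :=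
    fun p hp hR => center_ne_bot_of_isPGroup hp (isPGroup_of_forall_card_prime hR) hZ
  obtain ⟨R, -, hR⟩ := exists_le_card_prime (H := (⊤ : Subgroup G)) (by simp)
  by_cases hbot : ⊥ ∈ cdLattice G
  · have hnot := fun (Q : Subgroup G) hQ => notMem_cdLattice_of_card_prime hZ hbot (R := Q) hQ
    by_cases hnorm : ∀ g : G, R.map (MulAut.conj g).toMonoidHom = R
    · have := normal_of_map_conj_eq hnorm
      have h1 := hbot R
      rw [cdMeasure_bot] at h1
      exact (card_lt_of_normal_of_card_prime hR).not_ge h1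
    · push Not at hnorm
      obtain ⟨g, hg⟩ := hnorm
      have hc : Nat.card (R.map (MulAut.conj g).toMonoidHom) = Nat.card R :=
        Subgroup.card_map_of_injective (MulAut.conj g).injective
      refine hP _ hR fun Q hQ => ?_
      have h1 := (h _).1 (hnot R hR)
      have h2 := (h _).1 (hnot _ (hc.symm ▸ hR))
      rcases (h _).1 (hnot Q hQ) with h3 | h3 <;> grind
  · have htop : ⊤ ∉ cdLattice G := fun h1 => hbot (mem_cdLattice_of_le h1 (by
      rw [cdMeasure_top, cdMeasure_bot, hZ]; simp))
    have hne : ∀ Q : Subgroup G, (Nat.card Q).Prime → Q ∈ cdLattice G := by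
      intro Q hQ
      by_contra hQL
      have h1 : Q ≠ ⊥ := ne_bot_of_card_prime hQ
      have h2 : Q ≠ ⊤ := by
        rintro rfl
        exact center_ne_bot_of_isPGroup (G := G) hQ
          (IsPGroup.of_card (n := 1) (by simp)) hZ
      have h3 : (⊥ : Subgroup G) ≠ ⊤ := bot_ne_top
      have := (h _).1 hbot
      have := (h _).1 htop
      have := (h _).1 hQL
      grind
    refine hP _ hR fun Q hQ => ?_
    have h1 := (sup_inf_mem_cdLattice (hne R hR) (hne Q hQ)).2.1
    rcases eq_bot_or_eq_of_le_card_prime hR inf_le_left with h2 | h2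
    · exact absurd (h2 ▸ h1) hbot
    · rcases eq_bot_or_eq_of_le_card_prime hQ (inf_eq_left.1 h2) with h4 | h4
      · exact absurd h4 (ne_bot_of_card_prime hR)
      · rw [h4]

theorem top_mem_cdLattice {K : Subgroup G} (hne : center G ≠ ⊤) (hZ : center G ≠ ⊥)
    (h : ∀ H : Subgroup G, H ∉ cdLattice G ↔ H = ⊥ ∨ H = K) : ⊤ ∈ cdLattice G := by
  by_contra htop
  have hcen : center G ∉ cdLattice G := fun h1 => htop (mem_cdLattice_of_le h1 (by
    rw [cdMeasure_top, cdMeasure_center]))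
  have h1 := ((h _).1 hcen).resolve_left hZ
  rcases (h _).1 htop with h2 | h2
  · exact hZ (eq_bot_iff.2 (h2 ▸ le_top))
  · exact hne (h1.trans h2.symm)

theorem eq_of_card_prime_of_le_center [Finite G] {K : Subgroup G} (hne : center G ≠ ⊤)
    (h : ∀ H : Subgroup G, H ∉ cdLattice G ↔ H = ⊥ ∨ H = K) {P R : Subgroup G}
    (hP : (Nat.card P).Prime) (hPZ : P ≤ center G) (hR : (Nat.card R).Prime) : R = P := by
  by_contra hRP
  have hZ : center G ≠ ⊥ := fun h0 => ne_bot_of_card_prime hP (eq_bot_iff.2 (h0 ▸ hPZ))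
  have htop := top_mem_cdLattice hne hZ h
  have hcen : ∀ H : Subgroup G, H ≠ ⊥ → H ≠ K → H ∈ cdLattice G := fun H h1 h2 => by
    by_contra h3
    exact ((h H).1 h3).elim h1 h2
  have hPR : ¬ P ≤ R := fun hle =>
    (eq_bot_or_eq_of_le_card_prime hR hle).elim (ne_bot_of_card_prime hP) (hRP ·.symm)
  have hRK : R = K := by
    by_contra hRK
    exact hPR (hPZ.trans (center_le_of_mem_cdLattice (hcen R (ne_bot_of_card_prime hR) hRK)))
  subst hRK
  have hZP : center G = P := le_antisymm
    (center_le_of_mem_cdLattice (hcen P (ne_bot_of_card_prime hP) (Ne.symm hRP))) hPZ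
  have hnorm : R.Normal := normal_of_map_conj_eq fun g => by
    have h1 : R ∉ cdLattice G := (h R).2 (Or.inr rfl)
    rw [← map_mem_cdLattice_iff (MulAut.conj g), h] at h1
    refine h1.resolve_left fun h2 => ne_bot_of_card_prime hR ?_
    exact (Subgroup.map_eq_bot_iff_of_injective _ (MulAut.conj g).injective).1 h2
  have hsup : R ⊔ center G ∈ cdLattice G := hcen _
    (fun h0 => hZ (eq_bot_iff.2 (h0 ▸ le_sup_right)))
    (fun h0 => hPR (hPZ.trans (h0 ▸ le_sup_right)))
  have hinf : R ⊓ center G = ⊥ := (eq_bot_or_eq_of_le_card_prime hR inf_le_left).resolve_right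
    fun h1 => by
      rcases eq_bot_or_eq_of_le_card_prime hP (hZP ▸ inf_eq_left.1 h1) with h2 | h2
      · exact ne_bot_of_card_prime hR h2
      · exact hRP h2
  have hle : centralizer (R : Set G) ≤ centralizer ((R ⊔ center G : Subgroup G) : Set G) := by
    rw [le_centralizer_iff]
    exact sup_le (le_centralizer_iff.1 le_rfl) (center_le_centralizer _)
  have h1 := card_mul_card_le_sup_inf R (center G)
  rw [hinf, Subgroup.card_bot, mul_one] at h1
  have h2 := Nat.mul_le_mul h1 (Subgroup.card_le_of_le hle)
  have h3 := cdMeasure_eq_of_mem hsup htop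
  rw [cdMeasure_top, cdMeasure] at h3
  have h4 := card_lt_of_normal_of_card_prime hR
  have h5 : 0 < Nat.card (center G) := Nat.card_pos
  nlinarith

theorem exists_isPGroup_of_notMem_cdLattice_iff [Finite G] {K : Subgroup G} (hne : center G ≠ ⊤)
    (hZ : center G ≠ ⊥) (h : ∀ H : Subgroup G, H ∉ cdLattice G ↔ H = ⊥ ∨ H = K) :
    ∃ p : ℕ, p.Prime ∧ IsPGroup p G ∧ (∀ g : G, g ^ p = 1 → g ∈ center G) ∧
      ∀ g : G, g ∉ center G → center G ≤ zpowers g := by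
  obtain ⟨P, hPZ, hP⟩ := exists_le_card_prime hZ
  have huniq := fun (R : Subgroup G) hR =>
    eq_of_card_prime_of_le_center hne h hP hPZ (R := R) hR
  refine ⟨Nat.card P, hP, isPGroup_of_forall_card_prime fun R hR => by rw [huniq R hR],
    fun g hg => ?_, fun g hg => ?_⟩
  · by_cases h1 : g = 1
    · exact h1 ▸ one_mem _
    · have := Fact.mk hP
      rw [← zpowers_le, huniq (zpowers g) (by rwa [Nat.card_zpowers, orderOf_eq_prime hg h1])]
      exact hPZ
  · by_cases hgL : zpowers g ∈ cdLattice G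
    · exact center_le_of_mem_cdLattice hgL
    · have hg1 : zpowers g ≠ ⊥ := by
        rw [Ne, zpowers_eq_bot]
        rintro rfl
        exact hg (one_mem _)
      have hgK := ((h _).1 hgL).resolve_left hg1
      obtain ⟨R, hRg, hR⟩ := exists_le_card_prime hg1
      rw [huniq R hR] at hRg
      by_cases hPL : P ∈ cdLattice G
      · exact (center_le_of_mem_cdLattice hPL).trans hRg
      · have hPK := ((h _).1 hPL).resolve_left (ne_bot_of_card_prime hP)
        exact absurd (hPZ (by rw [hPK, ← hgK]; exact mem_zpowers g)) hg

theorem mem_of_zpow_mem_of_isPGroup {p : ℕ} (hp : p.Prime) (hG : IsPGroup p G) {H : Subgroup G}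
    {x : G} {i : ℤ} (hi : ¬ (p : ℤ) ∣ i) (hx : x ^ i ∈ H) : x ∈ H := by
  obtain ⟨k, hk⟩ := hG x
  obtain ⟨a, b, hab⟩ : IsCoprime i ((p : ℤ) ^ k) :=
    (((Nat.prime_iff_prime_int.1 hp).coprime_iff_not_dvd).2 hi).symm.pow_right
  have h1 : x = (x ^ i) ^ a := by
    rw [← zpow_mul]
    calc x = x ^ (a * i + b * (p : ℤ) ^ k) := by rw [hab, zpow_one]
      _ = x ^ (i * a) := by
        rw [zpow_add, mul_comm b, zpow_mul x ((p : ℤ) ^ k)]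
        rw [show x ^ ((p : ℤ) ^ k) = 1 by exact_mod_cast hk, one_zpow, mul_one, mul_comm]
  rw [h1]
  exact zpow_mem hx a

theorem mul_pow_of_mul_eq_mul_mul_center {a b c : G} (hc : c ∈ center G) (h : b * a = a * b * c)
    (n : ℕ) : b * a ^ n = a ^ n * b * c ^ n ∧ (a * b) ^ n = a ^ n * b ^ n * c ^ n.choose 2 := by
  have hc' : ∀ (m : ℕ) (g : G), c ^ m * g = g * c ^ m := fun m g =>
    (mem_center_iff.1 (pow_mem hc m) g).symm
  have key : ∀ n : ℕ, b ^ n * a = a * b ^ n * c ^ n := by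
    intro n
    induction n with
    | zero => simp
    | succ n ih =>
      calc b ^ (n + 1) * a = b ^ n * (b * a) := by rw [pow_succ, mul_assoc]
        _ = b ^ n * a * b * c := by rw [h]; simp only [mul_assoc]
        _ = a * b ^ n * (c ^ n * b) * c := by rw [ih]; simp only [mul_assoc]
        _ = a * b ^ (n + 1) * c ^ (n + 1) := by rw [hc', pow_succ, pow_succ]; simp only [mul_assoc]
  constructor
  · induction n with
    | zero => simp
    | succ n ih =>
      calc b * a ^ (n + 1) = b * a ^ n * a := by rw [pow_succ, mul_assoc]
        _ = a ^ n * b * (c ^ n * a) := by rw [ih]; simp only [mul_assoc]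
        _ = a ^ n * (b * a) * c ^ n := by rw [hc']; simp only [mul_assoc]
        _ = a ^ (n + 1) * b * c ^ (n + 1) := by
          rw [h, pow_succ a, pow_succ' c]; simp only [mul_assoc]
  · induction n with
    | zero => simp
    | succ n ih =>
      calc (a * b) ^ (n + 1) = a ^ n * b ^ n * (c ^ n.choose 2 * a) * b := by
            rw [pow_succ, ih]; simp only [mul_assoc]
        _ = a ^ n * (b ^ n * a) * (c ^ n.choose 2 * b) := by rw [hc']; simp only [mul_assoc]
        _ = a ^ n * a * b ^ n * (c ^ n * b) * c ^ n.choose 2 := by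
          rw [key, hc']; simp only [mul_assoc]
        _ = a ^ (n + 1) * b ^ (n + 1) * c ^ (n + 1).choose 2 := by
          rw [hc', Nat.choose_succ_succ' n 1, Nat.choose_one_right, pow_add c, pow_succ a n,
            pow_succ b n]
          simp only [mul_assoc]

theorem exists_pow_prime_mem_center [Finite G] {p : ℕ} (hp : p.Prime) (hG : IsPGroup p G)
    (hne : center G ≠ ⊤) : ∃ x : G, x ∉ center G ∧ x ^ p ∈ center G ∧
      ∀ g : G, ∃ c ∈ center G, g * x = x * g * c := by
  have := Fact.mk hp
  have : Nontrivial (G ⧸ center G) := QuotientGroup.nontrivial_iff.2 hne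
  have hQ : IsPGroup p (G ⧸ center G) := hG.to_quotient _
  have := hQ.center_nontrivial
  have hQZ : IsPGroup p (center (G ⧸ center G)) := hQ.to_subgroup _
  obtain ⟨n, hn, hn'⟩ := hQZ.nontrivial_iff_card.1 this
  obtain ⟨⟨q, hq⟩, hqo⟩ := exists_prime_orderOf_dvd_card' (G := center (G ⧸ center G)) p
    (hn' ▸ dvd_pow_self p hn.ne')
  obtain ⟨x, rfl⟩ := QuotientGroup.mk_surjective q
  rw [Subgroup.orderOf_mk] at hqo
  refine ⟨x, fun hx => ?_, ?_, fun g => ⟨(x * g)⁻¹ * (g * x), ?_, by group⟩⟩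
  · rw [(QuotientGroup.eq_one_iff x).2 hx, orderOf_one] at hqo
    exact hp.ne_one hqo.symm
  · rw [← QuotientGroup.eq_one_iff, QuotientGroup.mk_pow, ← hqo, pow_orderOf_eq_one]
  · rw [← QuotientGroup.eq]
    exact (mem_center_iff.1 hq (g : G ⧸ center G)).symm

/-- A nonabelian `p`-group in which the elements of order `p` are central and every noncentral
cyclic subgroup contains the centre is a `2`-group with centre of order `2`. -/
theorem exists_sq_eq_of_center_le_zpowers [Finite G] {p : ℕ} (hp : p.Prime) (hG : IsPGroup p G)
    (hne : center G ≠ ⊤) (hpow : ∀ g : G, g ^ p = 1 → g ∈ center G)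
    (hle : ∀ g : G, g ∉ center G → center G ≤ zpowers g) :
    p = 2 ∧ Nat.card (center G) = 2 ∧ ∃ x : G, x ∉ center G ∧ x ^ 2 ∈ center G ∧
      (∀ g : G, ∃ c ∈ center G, g * x = x * g * c) ∧
      ∀ g : G, ¬ Commute g x → g ^ 2 = x ^ 2 := by
  obtain ⟨x, hx, hxp, hcomm⟩ := exists_pow_prime_mem_center hp hG hne
  have hcp : ∀ g c : G, c ∈ center G → g * x = x * g * c → c ^ p = 1 := by
    intro g c hc h
    have h1 := (mul_pow_of_mul_eq_mul_mul_center hc h p).1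
    rw [mem_center_iff.1 hxp g] at h1
    exact mul_eq_left.1 h1.symm
  -- a noncentral power of `g` with the same `p`-th power as `x`
  have key : ∀ g : G, ¬ Commute g x → ∃ j : ℤ, ¬ (p : ℤ) ∣ j ∧ (g ^ j) ^ p = x ^ p ∧
      ¬ Commute (g ^ j) x := by
    intro g hgx
    have hg : g ∉ center G := fun h => hgx (mem_center_iff.1 h x).symm
    obtain ⟨i, hi⟩ := mem_zpowers_iff.1 (hle g hg hxp)
    obtain ⟨j, rfl⟩ : (p : ℤ) ∣ i := by
      by_contra h
      exact hg (mem_of_zpow_mem_of_isPGroup hp hG h (hi ▸ hxp))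
    have hj : (g ^ j) ^ p = x ^ p := by rw [← hi, ← zpow_natCast, ← zpow_mul, mul_comm]
    have hjx : ¬ Commute (g ^ j) x := by
      intro hc
      have h1 : x * (g ^ j)⁻¹ ∈ center G := hpow _ (by
        rw [(hc.symm.inv_right).mul_pow, inv_pow, hj, mul_inv_cancel])
      have h2 : Commute g (x * (g ^ j)⁻¹ * g ^ j) :=
        Commute.mul_right (mem_center_iff.1 h1 g) ((Commute.refl g).zpow_right j)
      rw [inv_mul_cancel_right] at h2
      exact hgx h2
    refine ⟨j, ?_, hj, hjx⟩
    rintro ⟨l, rfl⟩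
    obtain ⟨c, hc, h⟩ := hcomm (g ^ l)
    have h' : x * g ^ l = g ^ l * x * c⁻¹ := by rw [h, mul_inv_cancel_right]
    have h1 := (mul_pow_of_mul_eq_mul_mul_center (inv_mem hc) h' p).1
    rw [inv_pow, hcp _ c hc h, inv_one, mul_one, ← zpow_natCast, ← zpow_mul, mul_comm l] at h1
    exact hjx h1.symm
  obtain ⟨g, hg⟩ : ∃ g : G, ¬ Commute g x := by
    by_contra! h
    exact hx (mem_center_iff.2 h)
  obtain ⟨j, -, hj, hjx⟩ := key g hg
  set y := g ^ j
  obtain ⟨c, hc, hcy⟩ := hcomm y⁻¹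
  have hw : x * y⁻¹ ∉ center G := fun h => by
    have h2 : Commute y (x * y⁻¹ * y) := Commute.mul_right (mem_center_iff.1 h y) (Commute.refl y)
    rw [inv_mul_cancel_right] at h2
    exact hjx h2
  have hwp := (mul_pow_of_mul_eq_mul_mul_center hc hcy p).2
  rw [inv_pow, hj, mul_inv_cancel, one_mul] at hwp
  have hp2 : p = 2 := by
    by_contra h2
    obtain ⟨m, hm⟩ := hp.dvd_choose_self two_ne_zero (lt_of_le_of_ne hp.two_le (Ne.symm h2))
    rw [hm, pow_mul, hcp _ c hc hcy, one_pow] at hwp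
    exact hw (hpow _ hwp)
  subst hp2
  have := Fact.mk Nat.prime_two
  have hw2 : (x * y⁻¹) ^ 2 = c := by simpa using hwp
  have hZc : center G ≤ zpowers c := fun z hz => by
    obtain ⟨i, rfl⟩ := mem_zpowers_iff.1 (hle _ hw hz)
    obtain ⟨l, rfl⟩ : ((2 : ℕ) : ℤ) ∣ i := by
      by_contra h
      exact hw (mem_of_zpow_mem_of_isPGroup hp hG h hz)
    exact mem_zpowers_iff.2 ⟨l, by rw [← hw2, ← zpow_natCast, ← zpow_mul]⟩
  have hZ2 : Nat.card (center G) = 2 := by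
    have h1 := Subgroup.card_dvd_of_le hZc
    rw [Nat.card_zpowers] at h1
    have h2 := h1.trans (orderOf_dvd_of_pow_eq_one (hcp _ c hc hcy))
    refine ((Nat.dvd_prime hp).1 h2).resolve_left fun h3 => ?_
    have : Nontrivial G := ⟨x, 1, fun h => hx (h ▸ one_mem _)⟩
    exact center_ne_bot_of_isPGroup hp hG (Subgroup.card_eq_one.1 h3)
  refine ⟨rfl, hZ2, x, hx, hxp, hcomm, fun g hg => ?_⟩
  obtain ⟨j, hj2, hj, -⟩ := key g hg
  have hx4 : (x ^ 2) ^ 2 = 1 := by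
    have := pow_card_eq_one' (x := (⟨x ^ 2, hxp⟩ : center G))
    rw [hZ2] at this
    exact congrArg Subtype.val this
  have hg4 : g ^ 4 = 1 := mem_bot.1 (mem_of_zpow_mem_of_isPGroup hp hG (i := j) hj2 (by
    rw [mem_bot, ← hx4, ← hj, ← pow_mul, ← zpow_natCast, ← zpow_natCast, ← zpow_mul, ← zpow_mul,
      mul_comm]))
  obtain ⟨l, rfl⟩ : Odd j := Int.not_even_iff_odd.1 fun h => hj2 (by
    exact_mod_cast h.two_dvd)
  rw [← hj, ← zpow_natCast, ← zpow_natCast, ← zpow_mul,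
    show (2 * l + 1) * ((2 : ℕ) : ℤ) = ((4 : ℕ) : ℤ) * l + ((2 : ℕ) : ℤ) by push_cast; ring, zpow_add,
    zpow_mul, zpow_natCast g 4, hg4, one_zpow, one_mul]

theorem index_centralizer_singleton_of_card_center (hZ : Nat.card (center G) = 2) {x : G}
    (hx : x ∉ center G) (hcomm : ∀ g : G, ∃ c ∈ center G, g * x = x * g * c) :
    (centralizer {x}).index = 2 := by
  obtain ⟨z, hz⟩ : ∃ z : G, ∀ c ∈ center G, c = 1 ∨ c = z := by
    obtain ⟨a, b, -, hab⟩ := Nat.card_eq_two_iff.1 hZ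
    have hab' : ∀ c : center G, c = a ∨ c = b := fun c => by
      have : c ∈ ({a, b} : Set (center G)) := hab ▸ Set.mem_univ c
      simpa using this
    rcases hab' 1 with h1 | h1
    · exact ⟨b, fun c hc => (hab' ⟨c, hc⟩).imp (fun h => congrArg Subtype.val (h.trans h1.symm))
        (congrArg Subtype.val)⟩
    · exact ⟨a, fun c hc => (hab' ⟨c, hc⟩).symm.imp
        (fun h => congrArg Subtype.val (h.trans h1.symm)) (congrArg Subtype.val)⟩
  have hz' : ∀ g : G, g ∉ centralizer {x} → z ∈ center G ∧ g * x = x * g * z := fun g hg => by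
    obtain ⟨c, hc, h⟩ := hcomm g
    rcases hz c hc with rfl | rfl
    · exact absurd (mem_centralizer_singleton_iff.2 (by rw [h, mul_one])) hg
    · exact ⟨hc, h⟩
  obtain ⟨g, hg⟩ : ∃ g : G, g ∉ centralizer {x} := by
    by_contra! h
    exact hx (mem_center_iff.2 fun g => mem_centralizer_singleton_iff.1 (h g))
  obtain ⟨hzZ, hgx⟩ := hz' g hg
  have hzz : z * z = 1 := by
    have := pow_card_eq_one' (x := (⟨z, hzZ⟩ : center G))
    rw [hZ, sq] at this
    exact congrArg Subtype.val this
  refine index_eq_two_iff.2 ⟨g, fun b => ?_⟩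
  by_cases hb : b ∈ centralizer {x}
  · exact Or.inr ⟨hb, fun h => hg ((mul_mem_cancel_left hb).1 h)⟩
  · refine Or.inl ⟨mem_centralizer_singleton_iff.2 ?_, hb⟩
    calc b * g * x = b * x * (g * z) := by rw [mul_assoc, hgx]; simp only [mul_assoc]
      _ = x * b * (z * g) * z := by rw [(hz' b hb).2]; simp only [mul_assoc]
      _ = x * (b * g) * (z * z) := by
        rw [← mem_center_iff.1 hzZ g]; simp only [mul_assoc]
      _ = x * (b * g) := by rw [hzz, mul_one]

/-- A nontrivial group in which exactly `⊥` and one further subgroup lie outside `CD(G)` is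
abelian. -/
theorem center_eq_top_of_notMem_cdLattice_iff [Finite G] [Nontrivial G] {K : Subgroup G} (hK : K ≠ ⊥)
    (h : ∀ H : Subgroup G, H ∉ cdLattice G ↔ H = ⊥ ∨ H = K) : center G = ⊤ := by
  by_contra hne
  have hZ := center_ne_bot_of_notMem_cdLattice_iff h
  have htop := top_mem_cdLattice hne hZ h
  have hcenL : center G ∈ cdLattice G :=
    mem_cdLattice_of_le htop (by rw [cdMeasure_top, cdMeasure_center])
  have hKL : K ∉ cdLattice G := (h K).2 (Or.inr rfl)
  obtain ⟨p, hp, hG, hpow, hle⟩ := exists_isPGroup_of_notMem_cdLattice_iff hne hZ h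
  obtain ⟨rfl, hZ2, x, hx, hx2, hcomm, hsq⟩ :=
    exists_sq_eq_of_center_le_zpowers hp hG hne hpow hle
  have hcx := index_centralizer_singleton_of_card_center hZ2 hx hcomm
  obtain ⟨g, hg, hgL⟩ : ∃ g : G, ¬ Commute g x ∧ zpowers g ∈ cdLattice G := by
    obtain ⟨g, hg⟩ : ∃ g : G, ¬ Commute g x := by
      by_contra! hc
      exact hx (mem_center_iff.2 hc)
    have hK' : ∀ g : G, ¬ Commute g x → zpowers g ∉ cdLattice G → zpowers g = K :=
      fun g hg hgL => ((h _).1 hgL).resolve_left fun h1 =>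
        hg (zpowers_eq_bot.1 h1 ▸ Commute.one_left x)
    by_cases hgL : zpowers g ∈ cdLattice G
    · exact ⟨g, hg, hgL⟩
    · have hgx : ¬ Commute (g * x) x := fun hc => hg (by
        simpa using hc.mul_left (Commute.refl x).inv_left)
      refine ⟨g * x, hgx, by_contra fun hgxL => ?_⟩
      have h1 : g * x ∈ zpowers g := by
        rw [hK' g hg hgL, ← hK' _ hgx hgxL]
        exact mem_zpowers _
      obtain ⟨i, hi⟩ := mem_zpowers_iff.1 ((mul_mem_cancel_left (mem_zpowers g)).1 h1)
      exact hg (hi ▸ (Commute.refl g).zpow_right i)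
  have hg4 : g ^ 4 = 1 := by
    have := pow_card_eq_one' (x := (⟨x ^ 2, hx2⟩ : center G))
    rw [hZ2] at this
    rw [show (4 : ℕ) = 2 * 2 from rfl, pow_mul, hsq g hg]
    exact congrArg Subtype.val this
  have hcg : (centralizer {g}).index ≤ 2 := by
    have h1 := cdMeasure_eq_of_mem hgL htop
    have h2 : Nat.card (zpowers g) ≤ 4 := by
      rw [Nat.card_zpowers]
      exact orderOf_le_of_pow_eq_one (by norm_num) hg4
    rw [cdMeasure_top, cdMeasure, zpowers_eq_closure, centralizer_closure, ← zpowers_eq_closure,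
      hZ2, ← card_mul_index (centralizer {g})] at h1
    have h3 : 0 < Nat.card (centralizer {g}) := Nat.card_pos
    nlinarith
  have hD : centralizer {x} ⊓ centralizer {g} ≤ center G := by
    intro d hd
    have hdx : Commute d x := mem_centralizer_singleton_iff.1 hd.1
    have hdg : Commute d g := mem_centralizer_singleton_iff.1 hd.2
    by_contra hdZ
    obtain ⟨i, hi⟩ := mem_zpowers_iff.1 (hle d hdZ hx2)
    obtain ⟨j, rfl⟩ : ((2 : ℕ) : ℤ) ∣ i := by
      by_contra h2
      exact hdZ (mem_of_zpow_mem_of_isPGroup hp hG h2 (hi ▸ hx2))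
    have h1 : x * (d ^ j)⁻¹ ∈ center G := hpow _ (by
      rw [((hdx.zpow_left j).symm.inv_right).mul_pow, inv_pow, ← hi, ← zpow_natCast (d ^ j),
        ← zpow_mul, mul_comm j, mul_inv_cancel])
    have h2 : Commute g (x * (d ^ j)⁻¹ * d ^ j) :=
      Commute.mul_right (mem_center_iff.1 h1 g) (hdg.zpow_left j).symm
    rw [inv_mul_cancel_right] at h2
    exact hg h2
  have hG8 : Nat.card G ≤ 8 := by
    rw [← card_mul_index (centralizer {x} ⊓ centralizer {g})]
    have h1 := Subgroup.card_le_of_le hD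
    have h2 : (centralizer {x} ⊓ centralizer {g}).index ≤ 2 * 2 :=
      index_inf_le.trans (Nat.mul_le_mul hcx.le hcg)
    rw [hZ2] at h1
    exact Nat.mul_le_mul h1 h2
  have hKZ : ¬ K ≤ center G := fun hKZ =>
    (eq_bot_or_eq_of_le_card_prime (hZ2.symm ▸ hp) hKZ).elim hK fun h1 => hKL (h1 ▸ hcenL)
  have hZK : center G ≤ K := by
    obtain ⟨k, hk, hkZ⟩ := SetLike.not_le_iff_exists.1 hKZ
    exact (hle k hkZ).trans (zpowers_le.2 hk)
  have := Fact.mk hp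
  obtain ⟨n, hn⟩ := IsPGroup.iff_card.1 (hG.to_subgroup K)
  have h2n : 2 ≤ n := by
    by_contra hn2
    have h1 : Nat.card K ≤ Nat.card (center G) := by
      rw [hn, hZ2]
      exact (Nat.pow_le_pow_right two_pos (by lia : n ≤ 1)).trans_eq (pow_one 2)
    exact hKZ (Subgroup.eq_of_le_of_card_ge hZK h1).ge
  have hn3 : n < 3 := by
    by_contra hn3
    have h1 : 2 ^ 3 ≤ 2 ^ n := Nat.pow_le_pow_right two_pos (by lia)
    refine hKL ((Subgroup.eq_top_of_le_card K ?_) ▸ htop)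
    lia
  obtain rfl : n = 2 := by lia
  have : IsMulCommutative K := IsPGroup.isMulCommutative_of_card_eq_prime_sq hn
  have h1 := Subgroup.card_le_of_le (le_centralizer K)
  refine hKL (mem_cdLattice_of_le htop ?_)
  rw [cdMeasure_top, cdMeasure, hZ2]
  rw [hn] at h1 ⊢
  lia

theorem mem_cdLattice_iff_of_center_eq_top [Finite G] (h : center G = ⊤) (H : Subgroup G) :
    H ∈ cdLattice G ↔ H = ⊤ := by
  have hm : ∀ K : Subgroup G, cdMeasure G K = Nat.card K * Nat.card G := fun K => by
    rw [cdMeasure, centralizer_eq_top_iff_subset.2 (by simp [h]), card_top]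
  constructor
  · intro hH
    have h1 := hH ⊤
    rw [hm, hm, card_top] at h1
    exact Subgroup.eq_top_of_le_card H (Nat.le_of_mul_le_mul_right h1 Nat.card_pos)
  · rintro rfl K
    rw [hm, hm, card_top]
    exact Nat.mul_le_mul_right _ (Subgroup.card_le_card_group K)

theorem exists_isCyclic_card_eq_sq [Finite G] [Nontrivial G] {K : Subgroup G} (hK : K ≠ ⊥) (hK' : K ≠ ⊤)
    (h : ∀ H : Subgroup G, H = ⊤ ∨ H = ⊥ ∨ H = K) :
    IsCyclic G ∧ ∃ p : ℕ, p.Prime ∧ Nat.card G = p ^ 2 := by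
  obtain ⟨x, hx⟩ : ∃ x : G, x ∉ K := by
    by_contra! hc
    exact hK' (eq_top_iff.2 fun x _ => hc x)
  have hxt : zpowers x = ⊤ := by
    rcases h (zpowers x) with h1 | h1 | h1
    · exact h1
    · rw [zpowers_eq_bot] at h1
      exact absurd (h1 ▸ one_mem K) hx
    · exact absurd (h1 ▸ mem_zpowers x) hx
  refine ⟨isCyclic_iff_exists_zpowers_eq_top.2 ⟨x, hxt⟩, ?_⟩
  have hox : orderOf x = Nat.card G := by rw [← Nat.card_zpowers, hxt, card_top]
  have hcard : ∀ d m : ℕ, d * m = Nat.card G → d ≠ 1 → m ≠ 1 → d = Nat.card K := by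
    intro d m hdm hd hm
    have hpos : 0 < d * m := hdm ▸ Nat.card_pos
    have hm0 : 0 < m := Nat.pos_of_mul_pos_left hpos
    have hd0 : 0 < d := Nat.pos_of_mul_pos_right hpos
    have ho : Nat.card (zpowers (x ^ m)) = d := by
      rw [Nat.card_zpowers, orderOf_pow_of_dvd hm0.ne' (hox ▸ hdm ▸ dvd_mul_left m d), hox, ← hdm,
        Nat.mul_div_cancel _ hm0]
    rcases h (zpowers (x ^ m)) with h1 | h1 | h1
    · rw [h1, card_top, ← hdm] at ho
      exact absurd (Nat.eq_of_mul_eq_mul_left hd0 (ho.trans (mul_one d).symm)) hm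
    · rw [h1, card_bot] at ho
      exact absurd ho.symm hd
    · rw [← ho, h1]
  have hG1 : Nat.card G ≠ 1 := Finite.one_lt_card.ne'
  obtain ⟨R, -, hR⟩ := exists_le_card_prime hK
  have hRK : R = K := by
    rcases h R with h1 | h1 | h1
    · subst h1
      exact ((eq_bot_or_eq_of_le_card_prime hR le_top).elim hK hK').elim
    · exact absurd h1 (ne_bot_of_card_prime hR)
    · exact h1
  subst hRK
  refine ⟨Nat.card R, hR, ?_⟩
  have h1 := card_mul_index R
  have h2 := hcard R.index (Nat.card R) (by rw [mul_comm, h1])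
    (fun h0 => hK' (index_eq_one.1 h0)) hR.ne_one
  rw [← h1, h2, sq]

theorem card_subgroup_of_isCyclic_card_eq_sq [Finite G] [IsCyclic G] {p : ℕ} (hp : p.Prime)
    (hG : Nat.card G = p ^ 2) : Nat.card (Subgroup G) = 3 := by
  obtain ⟨x, hx⟩ := isCyclic_iff_exists_zpowers_eq_top.1 ‹IsCyclic G›
  have hox : orderOf x = p ^ 2 := by rw [← Nat.card_zpowers, hx, card_top, hG]
  have ho : Nat.card (zpowers (x ^ p)) = p := by
    rw [Nat.card_zpowers, orderOf_pow_of_dvd hp.ne_zero (hox ▸ dvd_pow_self p two_ne_zero), hox,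
      sq, Nat.mul_div_cancel _ hp.pos]
  have huniv : (Set.univ : Set (Subgroup G)) = {⊥, ⊤, zpowers (x ^ p)} := by
    refine (Set.eq_univ_of_forall fun H => ?_).symm
    simp only [Set.mem_insert_iff, Set.mem_singleton_iff]
    obtain ⟨k, hk2, hk⟩ := (Nat.dvd_prime_pow hp).1 (hG ▸ H.card_subgroup_dvd_card)
    have hle : k ≤ 1 → H ≤ zpowers (x ^ p) := fun hk1 y hy => by
      obtain ⟨i, rfl⟩ := mem_zpowers_iff.1 (hx ▸ mem_top y : y ∈ zpowers x)
      have h1 : (x ^ i) ^ p = 1 := by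
        have h2 := orderOf_dvd_iff_pow_eq_one.1 ((Subgroup.orderOf_mk _ hy ▸ orderOf_dvd_natCard _ :
          orderOf (x ^ i) ∣ Nat.card H).trans (hk ▸ pow_dvd_pow p hk1))
        simpa using h2
      rw [← zpow_natCast, ← zpow_mul, ← orderOf_dvd_iff_zpow_eq_one, hox] at h1
      push_cast at h1
      rw [sq] at h1
      obtain ⟨j, rfl⟩ := Int.dvd_of_mul_dvd_mul_right (by exact_mod_cast hp.ne_zero) h1
      exact mem_zpowers_iff.2 ⟨j, by rw [← zpow_natCast, ← zpow_mul]⟩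
    interval_cases k
    · exact Or.inl (Subgroup.card_eq_one.1 (by simpa using hk))
    · exact Or.inr (Or.inr (Subgroup.eq_of_le_of_card_ge (hle le_rfl) (by rw [ho, hk, pow_one])))
    · exact Or.inr (Or.inl (Subgroup.eq_top_of_le_card H (by rw [hG, hk])))
  have h1p : 1 < p := hp.one_lt
  have h2p : p < p ^ 2 := lt_self_pow₀ h1p one_lt_two
  have hne : ∀ {A B : Subgroup G}, Nat.card A < Nat.card B → A ≠ B := by
    rintro A B h rfl
    exact h.ne rfl
  rw [← Set.ncard_univ, huniv]
  rw [Set.ncard_eq_three]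
  refine ⟨_, _, _, hne ?_, hne ?_, (hne ?_).symm, rfl⟩
  · rw [card_bot, card_top, hG]; lia
  · rw [card_bot, ho]; exact h1p
  · rw [ho, card_top, hG]; exact h2p

end ChermakDelgado

/-- A finite group `G` satisfies `|CD(G)| = |L(G)| - 2` if and only if `G ≅ ℤ_{p²}`
for some prime `p`. -/
theorem cd_eq_sub_two_iff (G : Type*) [Group G] [Finite G] :
    Nat.card (cdLattice G) = Nat.card (Subgroup G) - 2 ↔
      ∃ p : ℕ, p.Prime ∧ Nonempty (G ≃* Multiplicative (ZMod (p ^ 2))) := by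
  constructor
  · intro hcard
    have hpos : 0 < Nat.card (cdLattice G) :=
      have := (cdLattice_nonempty (G := G)).to_subtype
      Nat.card_pos
    have : Nontrivial G := by
      by_contra hG
      rw [not_nontrivial_iff_subsingleton] at hG
      have : Nat.card (Subgroup G) ≤ 1 := Finite.card_le_one_iff_subsingleton.2 inferInstance
      lia
    have hcompl : (cdLattice G)ᶜ.ncard = 2 := by
      have := Set.ncard_add_ncard_compl (cdLattice G)
      rw [← Nat.card_coe_set_eq] at this
      lia
    obtain ⟨A, B, hAB, hset⟩ := Set.ncard_eq_two.1 hcompl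
    have hiff : ∀ H : Subgroup G, H ∉ cdLattice G ↔ H = A ∨ H = B := fun H => by
      rw [← Set.mem_compl_iff, hset]; simp
    have hZ := center_ne_bot_of_notMem_cdLattice_iff hiff
    have hbot : ⊥ ∉ cdLattice G := fun h => hZ (eq_bot_iff.2 (center_le_of_mem_cdLattice h))
    obtain ⟨K, hK, hiffK⟩ : ∃ K : Subgroup G, K ≠ ⊥ ∧
        ∀ H : Subgroup G, H ∉ cdLattice G ↔ H = ⊥ ∨ H = K := by
      rcases (hiff _).1 hbot with h1 | h1
      · exact ⟨B, h1 ▸ hAB.symm, h1 ▸ hiff⟩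
      · exact ⟨A, h1 ▸ hAB, fun H => by rw [hiff, h1, or_comm]⟩
    have htop := center_eq_top_of_notMem_cdLattice_iff hK hiffK
    have hmem := mem_cdLattice_iff_of_center_eq_top htop
    obtain ⟨hc, p, hp, hGp⟩ := exists_isCyclic_card_eq_sq hK
      (fun h => (hiffK K).2 (Or.inr rfl) ((hmem K).2 h))
      (fun H => by rw [← hiffK, ← hmem]; exact em _)
    exact ⟨p, hp, ⟨mulEquivOfCyclicCardEq (by
      rw [hGp, Nat.card_congr Multiplicative.toAdd, Nat.card_zmod])⟩⟩
  · rintro ⟨p, hp, ⟨e⟩⟩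
    have hG : Nat.card G = p ^ 2 := by 
      rw [Nat.card_congr e.toEquiv, Nat.card_congr Multiplicative.toAdd, Nat.card_zmod]
    have : IsCyclic G := e.isCyclic.2 inferInstance
    have hset : cdLattice G = {⊤} := Set.ext fun H =>
      mem_cdLattice_iff_of_center_eq_top Subgroup.center_eq_top H
    rw [card_subgroup_of_isCyclic_card_eq_sq hp hG, hset]
    simp
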